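/- Define F(r) := ((1 − √r)/(1 + √r))·exp(π·K(r)/K(√(1−r²))) for 0 < r < 1, where K denotes the complete elliptic integral of the first kind. Then F is strictly increasing on (0,1), F(r) → 1 as r → 0⁺, F(r) → 2 as r → 1⁻, and consequently 1 < F(r) < 2 for all 0 < r < 1. -/

import Mathlib

noncomputable def ellipticK (k : ℝ) : ℝ :=
  ∫ θ in (0:ℝ)..(Real.pi / 2), 1 / Real.sqrt (1 - k ^ 2 * Real.sin θ ^ 2)

noncomputable def ratioF (r : ℝ) : ℝ :=
  ((1 - Real.sqrt r) / (1 + Real.sqrt r)) *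
    Real.exp (Real.pi * ellipticK r / ellipticK (Real.sqrt (1 - r ^ 2)))

open Real Set Filter Topology

lemma one_sub_sq_mul_sin_sq_pos {k : ℝ} (h0 : 0 < k) (h1 : k < 1) (θ : ℝ) :
    0 < 1 - k ^ 2 * sin θ ^ 2 := by
  have h2 : k ^ 2 < 1 := by nlinarith
  nlinarith [sin_sq_le_one θ, sq_nonneg (sin θ)]

lemma continuous_ellipticK_integrand {k : ℝ} (h0 : 0 < k) (h1 : k < 1) :
    Continuous fun θ : ℝ => 1 / √(1 - k ^ 2 * sin θ ^ 2) :=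
  continuous_const.div (by fun_prop)
    fun θ => (sqrt_pos.2 (one_sub_sq_mul_sin_sq_pos h0 h1 θ)).ne'

/-- The modulus obtained from `r` by the ascending Landen transformation. -/
noncomputable def landen (r : ℝ) : ℝ := 2 * √r / (1 + r)

lemma landen_mem {r : ℝ} (hr : r ∈ Ioo (0 : ℝ) 1) : landen r ∈ Ioo (0 : ℝ) 1 := by
  obtain ⟨h0, h1⟩ := hr
  have hs := sqrt_pos.2 h0
  have hsq := sq_sqrt h0.le
  have hs1 : √r < 1 := by nlinarith
  unfold landen
  refine ⟨by positivity, ?_⟩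
  rw [div_lt_one (by positivity)]
  nlinarith [sq_pos_of_pos (sub_pos.2 hs1)]

lemma landen_strictMonoOn : StrictMonoOn landen (Ioo 0 1) := by
  rintro a ⟨ha0, ha1⟩ b ⟨hb0, hb1⟩ hab
  have hs := sqrt_pos.2 ha0
  have hs' := sqrt_lt_sqrt ha0.le hab
  have ha := sq_sqrt ha0.le
  have hb := sq_sqrt hb0.le
  have hb1' : √b < 1 := by nlinarith
  have hprod : √a * √b < 1 := by nlinarith
  unfold landen
  rw [div_lt_div_iff₀ (by positivity) (by positivity), ← sub_pos]
  have : 2 * √b * (1 + a) - 2 * √a * (1 + b) = 2 * (√b - √a) * (1 - √a * √b) := by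
    linear_combination (-2 * √b) * ha + (2 * √a) * hb
  rw [this]
  exact mul_pos (by linarith) (by linarith)

lemma continuousAt_landen {r : ℝ} (hr : 0 ≤ r) : ContinuousAt landen r := by
  unfold landen
  exact ContinuousAt.div (by fun_prop) (by fun_prop) (by positivity)

lemma sqrt_one_sub_landen_sq {r : ℝ} (hr : r ∈ Ioo (0 : ℝ) 1) :
    √(1 - landen r ^ 2) = (1 - r) / (1 + r) := by
  obtain ⟨h0, h1⟩ := hr
  have h : 1 - landen r ^ 2 = ((1 - r) / (1 + r)) ^ 2 := by
    unfold landen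
    have := sq_sqrt h0.le
    field_simp
    linear_combination (-4) * this
  rw [h, sqrt_sq (div_nonneg (by linarith) (by linarith))]

lemma hasDerivAt_arcsin_landen {k θ : ℝ} (h0 : 0 < k) (h1 : k < 1) (hθ : θ ∈ Ioo 0 (π / 2)) :
    HasDerivAt (fun θ => arcsin ((1 + k) * sin θ / (1 + k * sin θ ^ 2)))
      ((1 + k) * (1 - k * sin θ ^ 2) / ((1 + k * sin θ ^ 2) * √(1 - k ^ 2 * sin θ ^ 2))) θ := by
  have hs : 0 < sin θ := sin_pos_of_pos_of_lt_pi hθ.1 (by linarith [hθ.2, pi_pos])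
  have hc : 0 < cos θ := cos_pos_of_mem_Ioo ⟨by linarith [hθ.1, pi_pos], hθ.2⟩
  have hsc := sin_sq_add_cos_sq θ
  have hp := one_sub_sq_mul_sin_sq_pos h0 h1 θ
  have hq := sqrt_pos.2 hp
  have hqq := sq_sqrt hp.le
  have hden : 1 + k * sin θ ^ 2 ≠ 0 := by positivity
  set y := (1 + k) * sin θ / (1 + k * sin θ ^ 2) with hy
  have hcos : 1 - y ^ 2 = (cos θ * √(1 - k ^ 2 * sin θ ^ 2) / (1 + k * sin θ ^ 2)) ^ 2 := by
    rw [hy, div_pow, div_pow, mul_pow (cos θ), hqq, eq_div_iff (by positivity), sub_mul,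
      div_mul_cancel₀ _ (by positivity)]
    linear_combination (-(1 - k ^ 2 * sin θ ^ 2)) * hsc
  have hpos : 0 < 1 - y ^ 2 := by rw [hcos]; positivity
  have hd : HasDerivAt (fun θ => (1 + k) * sin θ / (1 + k * sin θ ^ 2))
      ((1 + k) * cos θ * (1 - k * sin θ ^ 2) / (1 + k * sin θ ^ 2) ^ 2) θ := by
    refine (((hasDerivAt_sin θ).const_mul (1 + k)).div
      ((((hasDerivAt_sin θ).pow 2).const_mul k).const_add 1) hden).congr_deriv ?_
    congr 1
    simp
    ring
  refine ((hasDerivAt_arcsin (by rintro h; rw [← hy] at h; norm_num [h] at hpos)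
    (by rintro h; rw [← hy] at h; norm_num [h] at hpos)).comp θ hd).congr_deriv ?_
  rw [← hy, hcos, sqrt_sq (by positivity)]
  field_simp

/-- Landen's transformation of the complete elliptic integral of the first kind. -/
lemma ellipticK_landen {k : ℝ} (hk : k ∈ Ioo (0 : ℝ) 1) :
    ellipticK (landen k) = (1 + k) * ellipticK k := by
  have hl := landen_mem hk
  obtain ⟨h0, h1⟩ := hk
  have hden : ∀ θ : ℝ, 0 < 1 + k * sin θ ^ 2 := fun θ => by positivity
  have hw : ∀ θ : ℝ, 0 < √(1 - k ^ 2 * sin θ ^ 2) := fun θ =>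
    sqrt_pos.2 (one_sub_sq_mul_sin_sq_pos h0 h1 θ)
  have hle : ∀ θ : ℝ, 0 < 1 - k * sin θ ^ 2 := fun θ => by
    nlinarith [sin_sq_le_one θ, sq_nonneg (sin θ)]
  have hend : (1 + k) * sin (π / 2) / (1 + k * sin (π / 2) ^ 2) = 1 := by
    rw [sin_pi_div_two, one_pow, mul_one, mul_one, div_self (by positivity)]
  have hf : Continuous fun θ => arcsin ((1 + k) * sin θ / (1 + k * sin θ ^ 2)) :=
    continuous_arcsin.comp (Continuous.div (by fun_prop) (by fun_prop) fun θ => (hden θ).ne')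
  have hf' : Continuous fun θ => (1 + k) * (1 - k * sin θ ^ 2) /
      ((1 + k * sin θ ^ 2) * √(1 - k ^ 2 * sin θ ^ 2)) :=
    Continuous.div (by fun_prop) (by fun_prop) fun θ => (mul_pos (hden θ) (hw θ)).ne'
  have hderiv : ∀ θ ∈ Ioo (min 0 (π / 2)) (max 0 (π / 2)), HasDerivWithinAt
      (fun θ => arcsin ((1 + k) * sin θ / (1 + k * sin θ ^ 2)))
      ((1 + k) * (1 - k * sin θ ^ 2) / ((1 + k * sin θ ^ 2) * √(1 - k ^ 2 * sin θ ^ 2)))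
      (Ioi θ) θ := by
    intro θ hθ
    rw [min_eq_left pi_div_two_pos.le, max_eq_right pi_div_two_pos.le] at hθ
    exact (hasDerivAt_arcsin_landen h0 h1 hθ).hasDerivWithinAt
  have hg := continuous_ellipticK_integrand hl.1 hl.2
  have key := intervalIntegral.integral_comp_mul_deriv'' hf.continuousOn hderiv hf'.continuousOn
    hg.continuousOn
  simp only [hend, sin_zero, mul_zero, zero_div, arcsin_zero, arcsin_one] at key
  rw [ellipticK, ← key, ellipticK, ← intervalIntegral.integral_const_mul]
  refine intervalIntegral.integral_congr fun θ hθ => ?_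
  rw [uIcc_of_le (by positivity)] at hθ
  have hs : 0 ≤ sin θ := sin_nonneg_of_nonneg_of_le_pi hθ.1 (by linarith [hθ.2, pi_pos])
  have hs1 := sin_le_one θ
  have hd := hden θ
  have hd' := hle θ
  have hsin : sin (arcsin ((1 + k) * sin θ / (1 + k * sin θ ^ 2))) =
      (1 + k) * sin θ / (1 + k * sin θ ^ 2) := by
    apply sin_arcsin
    · linarith [show 0 ≤ (1 + k) * sin θ / (1 + k * sin θ ^ 2) by positivity]
    · rw [div_le_one hd]
      nlinarith [mul_nonneg (sub_nonneg.2 hs1) (sub_nonneg.2 (show k * sin θ ≤ 1 by nlinarith))]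
  have hsq : 1 - landen k ^ 2 * ((1 + k) * sin θ / (1 + k * sin θ ^ 2)) ^ 2 =
      ((1 - k * sin θ ^ 2) / (1 + k * sin θ ^ 2)) ^ 2 := by
    have := sq_sqrt h0.le
    unfold landen
    field_simp
    linear_combination (-4 * sin θ ^ 2) * this
  have := hw θ
  simp only [Function.comp_apply, hsin, hsq]
  rw [sqrt_sq (by positivity)]
  field_simp

lemma ellipticK_compl_eq {r : ℝ} (hr : r ∈ Ioo (0 : ℝ) 1) :
    ellipticK √(1 - r ^ 2) = 2 / (1 + r) * ellipticK √(1 - landen r ^ 2) := by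
  rw [sqrt_one_sub_landen_sq hr]
  obtain ⟨h0, h1⟩ := hr
  have hρ : (1 - r) / (1 + r) ∈ Ioo (0 : ℝ) 1 :=
    ⟨div_pos (by linarith) (by linarith), by rw [div_lt_one (by linarith)]; linarith⟩
  have hsum : 1 + (1 - r) / (1 + r) = 2 / (1 + r) := by field_simp; ring
  have hl : landen ((1 - r) / (1 + r)) = √(1 - r ^ 2) := by
    rw [landen, hsum, show (1 - r) / (1 + r) = (1 - r ^ 2) / (1 + r) ^ 2 by field_simp; ring,
      sqrt_div' _ (by positivity), sqrt_sq (by positivity)]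
    field_simp
  rw [← hl, ellipticK_landen hρ, hsum]

lemma pi_div_two_le_ellipticK {k : ℝ} (hk : k ∈ Ioo (0 : ℝ) 1) : π / 2 ≤ ellipticK k := by
  have h := intervalIntegral.integral_mono_on (a := 0) (b := π / 2) (f := fun _ => (1 : ℝ))
    (μ := MeasureTheory.volume) (by positivity) intervalIntegrable_const
    ((continuous_ellipticK_integrand hk.1 hk.2).intervalIntegrable _ _)
    fun θ _ => by
      rw [le_div_iff₀ (sqrt_pos.2 (one_sub_sq_mul_sin_sq_pos hk.1 hk.2 θ)), one_mul, sqrt_le_one]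
      nlinarith [mul_nonneg (sq_nonneg k) (sq_nonneg (sin θ))]
  simpa [ellipticK] using h

lemma sqrt_one_sub_sq_mem {r : ℝ} (hr : r ∈ Ioo (0 : ℝ) 1) : √(1 - r ^ 2) ∈ Ioo (0 : ℝ) 1 := by
  obtain ⟨h0, h1⟩ := hr
  refine ⟨sqrt_pos.2 (by nlinarith), ?_⟩
  rw [sqrt_lt' one_pos]
  nlinarith

lemma ellipticK_compl_le {r : ℝ} (hr : r ∈ Ioo (0 : ℝ) 1) :
    ellipticK √(1 - r ^ 2) ≤ π / (2 * r) := by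
  have hk := sqrt_one_sub_sq_mem hr
  obtain ⟨h0, h1⟩ := hr
  have h := intervalIntegral.integral_mono_on (a := 0) (b := π / 2) (g := fun _ => 1 / r)
    (μ := MeasureTheory.volume) (by positivity) ((continuous_ellipticK_integrand hk.1 hk.2).intervalIntegrable _ _)
    intervalIntegrable_const
    fun θ _ => by
      refine one_div_le_one_div_of_le h0 (le_sqrt_of_sq_le ?_)
      rw [sq_sqrt (by nlinarith)]
      nlinarith [mul_nonneg (show 0 ≤ 1 - r ^ 2 by nlinarith) (sub_nonneg.2 (sin_sq_le_one θ))]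
  refine h.trans_eq ?_
  rw [intervalIntegral.integral_const, smul_eq_mul]
  field_simp
  ring

lemma integral_sin_div_sqrt {r : ℝ} (hr : r ∈ Ioo (0 : ℝ) 1) :
    ∫ θ in (0 : ℝ)..(π / 2), sin θ / √(1 - r ^ 2 * sin θ ^ 2) =
      log ((1 + r) / (1 - r)) / (2 * r) := by
  obtain ⟨h0, h1⟩ := hr
  have hw := one_sub_sq_mul_sin_sq_pos h0 h1
  have hc : Continuous fun θ => sin θ / √(1 - r ^ 2 * sin θ ^ 2) :=
    continuous_sin.div (by fun_prop) fun θ => (sqrt_pos.2 (hw θ)).ne'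
  have hb : 0 < 1 - r ^ 2 := by nlinarith
  have hs := sqrt_pos.2 hb
  have hss := sq_sqrt hb.le
  have hd : ∀ θ ∈ uIcc 0 (π / 2), HasDerivAt
      (fun θ => -(1 / r) * arsinh (r * cos θ / √(1 - r ^ 2)))
      (sin θ / √(1 - r ^ 2 * sin θ ^ 2)) θ := by
    intro θ _
    refine ((((hasDerivAt_cos θ).const_mul r).div_const √(1 - r ^ 2)).arsinh.const_mul
      (-(1 / r))).congr_deriv ?_
    have : 1 + (r * cos θ / √(1 - r ^ 2)) ^ 2 = (1 - r ^ 2 * sin θ ^ 2) / (1 - r ^ 2) := by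
      rw [div_pow, hss]
      field_simp
      linear_combination r ^ 2 * sin_sq_add_cos_sq θ
    have hw' := sqrt_pos.2 (hw θ)
    rw [this, sqrt_div' _ hb.le, smul_eq_mul]
    field_simp
  rw [intervalIntegral.integral_eq_sub_of_hasDerivAt hd (hc.intervalIntegrable _ _)]
  have hval : arsinh (r / √(1 - r ^ 2)) = log ((1 + r) / (1 - r)) / 2 := by
    have : 1 + (r / √(1 - r ^ 2)) ^ 2 = 1 / (1 - r ^ 2) := by
      rw [div_pow, hss]
      field_simp
      ring
    rw [arsinh, this, sqrt_div' _ hb.le, sqrt_one, ← add_div, ← log_sqrt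
      (div_nonneg (by linarith) (by linarith))]
    congr 1
    rw [eq_comm, sqrt_eq_iff_mul_self_eq (div_nonneg (by linarith) (by linarith)) (by positivity)]
    have : 1 - r ≠ 0 := by linarith
    rw [← sq, div_pow, hss]
    field_simp
    ring
  simp only [cos_pi_div_two, cos_zero, mul_zero, mul_one, zero_div, arsinh_zero, hval]
  field_simp
  ring

lemma ellipticK_lower {r : ℝ} (hr : r ∈ Ioo (0 : ℝ) 1) :
    log ((1 + r) / (1 - r)) / (2 * r) ≤ ellipticK r := by
  have hw := one_sub_sq_mul_sin_sq_pos hr.1 hr.2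
  rw [← integral_sin_div_sqrt hr]
  refine intervalIntegral.integral_mono_on (by positivity)
    ((continuous_sin.div (by fun_prop) fun θ => (sqrt_pos.2 (hw θ)).ne').intervalIntegrable _ _)
    ((continuous_ellipticK_integrand hr.1 hr.2).intervalIntegrable _ _) fun θ _ => ?_
  have := sin_le_one θ
  gcongr

lemma ellipticK_upper {r : ℝ} (hr : r ∈ Ioo (0 : ℝ) 1) :
    ellipticK r ≤ log ((1 + r) / (1 - r)) / (2 * r) + π / 2 := by
  have hw := one_sub_sq_mul_sin_sq_pos hr.1 hr.2
  have hi : IntervalIntegrable (fun θ => sin θ / √(1 - r ^ 2 * sin θ ^ 2))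
      MeasureTheory.volume 0 (π / 2) :=
    (continuous_sin.div (by fun_prop) fun θ => (sqrt_pos.2 (hw θ)).ne').intervalIntegrable _ _
  have h := intervalIntegral.integral_mono_on (a := 0) (b := π / 2) (by positivity)
    ((continuous_ellipticK_integrand hr.1 hr.2).intervalIntegrable _ _)
    (hi.add (intervalIntegrable_const (c := (1 : ℝ)))) fun θ hθ => by
      have hs : 0 ≤ sin θ := sin_nonneg_of_nonneg_of_le_pi hθ.1 (by linarith [hθ.2, pi_pos])
      have hs1 := sin_le_one θ
      have hpos := sqrt_pos.2 (hw θ)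
      rw [div_add_one hpos.ne']
      gcongr
      have : 1 - sin θ ≤ √(1 - r ^ 2 * sin θ ^ 2) := by
        apply le_sqrt_of_sq_le
        have : r ^ 2 * sin θ ^ 2 ≤ 1 * sin θ ^ 2 := by
          gcongr
          nlinarith [hr.1, hr.2]
        nlinarith
      linarith
  rw [intervalIntegral.integral_add hi (by simp), integral_sin_div_sqrt hr] at h
  simpa [ellipticK] using h

lemma one_sub_sqrt_div_pos {r : ℝ} (hr : r ∈ Ioo (0 : ℝ) 1) : 0 < (1 - √r) / (1 + √r) := by
  have : √r < 1 := by rw [sqrt_lt' one_pos]; linarith [hr.2]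
  exact div_pos (by linarith) (by positivity)

lemma ratioF_pos {r : ℝ} (hr : r ∈ Ioo (0 : ℝ) 1) : 0 < ratioF r :=
  mul_pos (one_sub_sqrt_div_pos hr) (exp_pos _)

lemma one_sub_sqrt_div_eq {r : ℝ} (hr : r ∈ Ioo (0 : ℝ) 1) :
    (1 - √r) / (1 + √r) = (1 - r) / (1 + √r) ^ 2 := by
  have := sq_sqrt hr.1.le
  field_simp
  linear_combination -this

lemma one_fourth_le_ratioF {r : ℝ} (hr : r ∈ Ioo (0 : ℝ) 1) : 1 / 4 ≤ ratioF r := by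
  have hK := ellipticK_lower hr
  have hc := ellipticK_compl_le hr
  have hc' := pi_div_two_le_ellipticK (sqrt_one_sub_sq_mem hr)
  have hπ := pi_pos
  have heq := one_sub_sqrt_div_eq hr
  obtain ⟨h0, h1⟩ := hr
  have h1r : 0 < 1 - r := by linarith
  have hc0 : 0 ≤ ellipticK √(1 - r ^ 2) := by linarith
  have hexp : log ((1 + r) / (1 - r)) ≤ π * ellipticK r / ellipticK √(1 - r ^ 2) := by
    rw [div_le_iff₀ (by positivity)] at hK
    rw [le_div_iff₀ (by linarith)]
    have hlog : 0 ≤ log ((1 + r) / (1 - r)) :=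
      log_nonneg (by rw [le_div_iff₀ h1r]; linarith)
    calc log ((1 + r) / (1 - r)) * ellipticK √(1 - r ^ 2)
        ≤ (ellipticK r * (2 * r)) * (π / (2 * r)) := mul_le_mul hK hc hc0 (hlog.trans hK)
      _ = π * ellipticK r := by field_simp
  have hE : (1 + r) / (1 - r) ≤ exp (π * ellipticK r / ellipticK √(1 - r ^ 2)) := by
    rwa [← log_le_iff_le_exp (by positivity)]
  have hs1 : √r ≤ 1 := sqrt_le_one.2 h1.le
  rw [ratioF, heq]
  calc (1 : ℝ) / 4 ≤ (1 + r) / (1 + √r) ^ 2 := by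
        rw [div_le_div_iff₀ (by norm_num) (by positivity)]
        nlinarith [sqrt_nonneg r]
    _ = (1 - r) / (1 + √r) ^ 2 * ((1 + r) / (1 - r)) := by field_simp
    _ ≤ _ := by gcongr

lemma ratioF_le {r : ℝ} (hr : r ∈ Ioo (0 : ℝ) 1) : ratioF r ≤ 2 * exp (2 + π) := by
  have hK := ellipticK_upper hr
  have hK' := pi_div_two_le_ellipticK hr
  have hc := pi_div_two_le_ellipticK (sqrt_one_sub_sq_mem hr)
  have hπ := pi_pos
  have heq := one_sub_sqrt_div_eq hr
  obtain ⟨h0, h1⟩ := hr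
  have h1r : 0 < 1 - r := by linarith
  have hK0 : 0 ≤ ellipticK r := by linarith
  have hexp : π * ellipticK r / ellipticK √(1 - r ^ 2) ≤
      log ((1 + r) / (1 - r)) + (2 + π) := by
    have hlog : log ((1 + r) / (1 - r)) ≤ 2 * r / (1 - r) := by
      refine (log_le_sub_one_of_pos (by positivity)).trans_eq ?_
      field_simp
      ring
    have hdiff : log ((1 + r) / (1 - r)) / r ≤ log ((1 + r) / (1 - r)) + 2 := by
      rw [le_div_iff₀ h1r] at hlog
      rw [div_le_iff₀ h0]
      linarith
    rw [div_le_iff₀ (by linarith)]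
    have h2 : 2 * ellipticK r ≤ log ((1 + r) / (1 - r)) + (2 + π) := by
      have : log ((1 + r) / (1 - r)) / (2 * r) = log ((1 + r) / (1 - r)) / r / 2 := by
        field_simp
      linarith
    calc π * ellipticK r = (2 * ellipticK r) * (π / 2) := by ring
      _ ≤ (2 * ellipticK r) * ellipticK √(1 - r ^ 2) := by gcongr
      _ ≤ _ := by gcongr; linarith
  have hE : exp (π * ellipticK r / ellipticK √(1 - r ^ 2)) ≤
      (1 + r) / (1 - r) * exp (2 + π) := by
    refine (exp_le_exp.2 hexp).trans_eq ?_
    rw [exp_add, exp_log (by positivity)]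
  rw [ratioF, heq]
  calc _ ≤ (1 - r) / (1 + √r) ^ 2 * ((1 + r) / (1 - r) * exp (2 + π)) := by gcongr
    _ = (1 + r) / (1 + √r) ^ 2 * exp (2 + π) := by field_simp
    _ ≤ 2 * exp (2 + π) := by
      gcongr
      rw [div_le_iff₀ (by positivity)]
      nlinarith [sqrt_nonneg r]

lemma ratioF_sq {r : ℝ} (hr : r ∈ Ioo (0 : ℝ) 1) :
    ratioF r ^ 2 = ratioF (landen r) * (1 + landen (landen r)) := by
  have hl := landen_mem hr
  have hc := pi_div_two_le_ellipticK (sqrt_one_sub_sq_mem hl)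
  have hexp : π * ellipticK (landen r) / ellipticK √(1 - landen r ^ 2) =
      2 * (π * ellipticK r / ellipticK √(1 - r ^ 2)) := by
    have : ellipticK √(1 - landen r ^ 2) ≠ 0 := by linarith [pi_pos]
    have := hr.1
    rw [ellipticK_compl_eq hr, ellipticK_landen hr]
    field_simp
  have hsq := sq_sqrt hr.1.le
  have hsq' := sq_sqrt hl.1.le
  have hpos := hr.1
  have hlpos := hl.1
  have hbase : ((1 - √r) / (1 + √r)) ^ 2 = (1 - landen r) / (1 + landen r) := by
    have h : 1 + landen r = (1 + √r) ^ 2 / (1 + r) := by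
      rw [landen]; field_simp; linear_combination -hsq
    have h' : 1 - landen r = (1 - √r) ^ 2 / (1 + r) := by
      rw [landen]; field_simp; linear_combination -hsq
    rw [h, h']
    field_simp
  have hstep : (1 - landen r) / (1 + landen r) =
      (1 - √(landen r)) / (1 + √(landen r)) * (1 + landen (landen r)) := by
    rw [landen.eq_1 (landen r)]
    field_simp
    linear_combination 2 * hsq'
  rw [ratioF, ratioF, hexp, mul_pow, hbase, hstep, ← exp_nat_mul]
  push_cast
  ring

lemma ratioF_strictMonoOn : StrictMonoOn ratioF (Ioo 0 1) := by
  have hrec : ∀ r ∈ Ioo (0 : ℝ) 1,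
      2 * log (ratioF r) = log (ratioF (landen r)) + log (1 + landen (landen r)) := by
    intro r hr
    have h2 := (landen_mem (landen_mem hr)).1
    rw [← log_mul (ratioF_pos (landen_mem hr)).ne' (by positivity), ← ratioF_sq hr, log_pow]
    simp
  have hlt : ∀ a ∈ Ioo (0 : ℝ) 1, ∀ b ∈ Ioo (0 : ℝ) 1, a < b →
      log (1 + landen (landen a)) < log (1 + landen (landen b)) := by
    intro a ha b hb hab
    have h2 := (landen_mem (landen_mem ha)).1
    have := landen_strictMonoOn (landen_mem ha) (landen_mem hb) (landen_strictMonoOn ha hb hab)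
    exact log_lt_log (by positivity) (by linarith)
  obtain ⟨C, hC⟩ : ∃ C, ∀ a ∈ Ioo (0 : ℝ) 1, ∀ b ∈ Ioo (0 : ℝ) 1,
      log (ratioF a) - log (ratioF b) ≤ C := by
    refine ⟨log (2 * exp (2 + π)) - log (1 / 4), fun a ha b hb => ?_⟩
    gcongr
    exacts [ratioF_pos ha, ratioF_le ha, one_fourth_le_ratioF hb]
  have hiter : ∀ n : ℕ, ∀ a ∈ Ioo (0 : ℝ) 1, ∀ b ∈ Ioo (0 : ℝ) 1, a < b →
      log (ratioF a) - log (ratioF b) ≤ C * (1 / 2) ^ n := by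
    intro n
    induction n with
    | zero => intro a ha b hb _; simpa using hC a ha b hb
    | succ n ih =>
      intro a ha b hb hab
      have h1 := ih _ (landen_mem ha) _ (landen_mem hb) (landen_strictMonoOn ha hb hab)
      have h2 := hlt a ha b hb hab
      have h3 := hrec a ha
      have h4 := hrec b hb
      rw [pow_succ]
      linarith
  have hmono : ∀ a ∈ Ioo (0 : ℝ) 1, ∀ b ∈ Ioo (0 : ℝ) 1, a < b →
      log (ratioF a) - log (ratioF b) ≤ 0 := by
    intro a ha b hb hab
    have ht : Tendsto (fun n : ℕ => C * (1 / 2 : ℝ) ^ n) atTop (𝓝 0) := by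
      simpa using (tendsto_pow_atTop_nhds_zero_of_lt_one (r := (1 / 2 : ℝ))
        (by norm_num) (by norm_num)).const_mul C
    exact ge_of_tendsto' ht fun n => hiter n a ha b hb hab
  intro a ha b hb hab
  rw [← log_lt_log_iff (ratioF_pos ha) (ratioF_pos hb)]
  have h1 := hmono _ (landen_mem ha) _ (landen_mem hb) (landen_strictMonoOn ha hb hab)
  have h2 := hlt a ha b hb hab
  have h3 := hrec a ha
  have h4 := hrec b hb
  linarith

/-- A nonzero limit of `ratioF` along a `landen`-invariant filter converging to `c` equals `1 + c`. -/
lemma eq_one_add_of_tendsto_ratioF {l : Filter ℝ} [l.NeBot] {c L : ℝ}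
    (hl : l ≤ 𝓝 c) (hmem : ∀ᶠ r in l, r ∈ Ioo (0 : ℝ) 1)
    (hlanden : Tendsto landen l l) (hL : Tendsto ratioF l (𝓝 L)) (hL0 : L ≠ 0) : L = 1 + c := by
  have ht : Tendsto landen l (𝓝 c) := hlanden.mono_right hl
  have h := (hL.comp hlanden).mul ((ht.comp hlanden).const_add 1)
  have h' : Tendsto (fun r => ratioF r ^ 2) l (𝓝 (L * (1 + c))) :=
    h.congr' (hmem.mono fun r hr => (ratioF_sq hr).symm)
  have := tendsto_nhds_unique (hL.pow 2) h'
  exact mul_left_cancel₀ hL0 (by rw [← this, sq])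

lemma tendsto_ratioF_zero : Tendsto ratioF (𝓝[>] 0) (𝓝 1) := by
  have hlim := ratioF_strictMonoOn.monotoneOn.tendsto_nhdsWithin_Ioo_right (nonempty_Ioo.2 one_pos)
    ⟨1 / 4, by rintro _ ⟨r, hr, rfl⟩; exact one_fourth_le_ratioF hr⟩
  have hmem : ∀ᶠ r : ℝ in 𝓝[>] 0, r ∈ Ioo (0 : ℝ) 1 := Ioo_mem_nhdsGT one_pos
  have hfix : landen 0 = 0 := by simp [landen]
  have hpos : (1 / 4 : ℝ) ≤ sInf (ratioF '' Ioo 0 1) :=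
    ge_of_tendsto hlim (hmem.mono fun r hr => one_fourth_le_ratioF hr)
  have hlanden : Tendsto landen (𝓝[>] 0) (𝓝[>] 0) :=
    tendsto_nhdsWithin_iff.2 ⟨by
      simpa [hfix] using (continuousAt_landen le_rfl).tendsto.mono_left nhdsWithin_le_nhds,
      hmem.mono fun r hr => (landen_mem hr).1⟩
  have := eq_one_add_of_tendsto_ratioF nhdsWithin_le_nhds hmem hlanden hlim
    (by linarith)
  rwa [this, add_zero] at hlim

lemma tendsto_ratioF_one : Tendsto ratioF (𝓝[<] 1) (𝓝 2) := by
  have hlim := ratioF_strictMonoOn.monotoneOn.tendsto_nhdsWithin_Ioo_left (nonempty_Ioo.2 one_pos)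
    ⟨2 * exp (2 + π), by rintro _ ⟨r, hr, rfl⟩; exact ratioF_le hr⟩
  have hmem : ∀ᶠ r : ℝ in 𝓝[<] 1, r ∈ Ioo (0 : ℝ) 1 := Ioo_mem_nhdsLT one_pos
  have hfix : landen 1 = 1 := by norm_num [landen]
  have hpos : (1 / 4 : ℝ) ≤ sSup (ratioF '' Ioo 0 1) :=
    ge_of_tendsto hlim (hmem.mono fun r hr => one_fourth_le_ratioF hr)
  have hlanden : Tendsto landen (𝓝[<] 1) (𝓝[<] 1) :=
    tendsto_nhdsWithin_iff.2 ⟨by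
      simpa [hfix] using (continuousAt_landen zero_le_one).tendsto.mono_left nhdsWithin_le_nhds,
      hmem.mono fun r hr => (landen_mem hr).2⟩
  have := eq_one_add_of_tendsto_ratioF nhdsWithin_le_nhds hmem hlanden hlim
    (by linarith)
  rwa [this, one_add_one_eq_two] at hlim

theorem stmt_19 :
    StrictMonoOn ratioF (Set.Ioo 0 1) ∧
    Filter.Tendsto ratioF (nhdsWithin 0 (Set.Ioi 0)) (nhds 1) ∧
    Filter.Tendsto ratioF (nhdsWithin 1 (Set.Iio 1)) (nhds 2) ∧
    ∀ r ∈ Set.Ioo (0:ℝ) 1, 1 < ratioF r ∧ ratioF r < 2 := by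
  refine ⟨ratioF_strictMonoOn, tendsto_ratioF_zero, tendsto_ratioF_one, fun r hr => ?_⟩
  obtain ⟨a, ha0, har⟩ := exists_between hr.1
  obtain ⟨b, hrb, hb1⟩ := exists_between hr.2
  have ha : a ∈ Ioo (0 : ℝ) 1 := ⟨ha0, har.trans hr.2⟩
  have hb : b ∈ Ioo (0 : ℝ) 1 := ⟨hr.1.trans hrb, hb1⟩
  constructor
  · refine (le_of_tendsto tendsto_ratioF_zero ?_).trans_lt (ratioF_strictMonoOn ha hr har)
    filter_upwards [Ioo_mem_nhdsGT ha0] with x hx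
    exact (ratioF_strictMonoOn ⟨hx.1, hx.2.trans ha.2⟩ ha hx.2).le
  · refine (ratioF_strictMonoOn hr hb hrb).trans_le (ge_of_tendsto tendsto_ratioF_one ?_)
    filter_upwards [Ioo_mem_nhdsLT hb1] with x hx
    exact (ratioF_strictMonoOn hb ⟨hb.1.trans hx.1, hx.2⟩ hx.1).le
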